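/- arXiv:1805.06685 — 2 statements merged into one kernel-verified Lean document; each statement's English description precedes it below -/
import Mathlib

section
/- Let 𝓜 be a finite nonempty set of n×n binary NZ matrices and t ≥ 0. If K_𝓜(t) < 1 then K_𝓜(t) ≤ (n²−1)/n². -/
open scoped BigOperators

/-- Binary (Boolean) `n × n` matrices. -/
abbrev BMat (n : ℕ) := Matrix (Fin n) (Fin n) Bool

/-- Boolean matrix product: `(A ⊙ B)[i,j] = 1` iff `∑ₖ A[i,k]·B[k,j] > 0`. -/
def bProd {n : ℕ} (A B : BMat n) : BMat n :=
  Matrix.of fun i j => decide (∃ k, A i k = true ∧ B k j = true)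

/-- The identity binary matrix. -/
def bId (n : ℕ) : BMat n := Matrix.of fun i j => decide (i = j)

/-- The all-ones binary matrix. -/
def bOnes (n : ℕ) : BMat n := Matrix.of fun _ _ => true

/-- Boolean product of a list of binary matrices (empty product = identity). -/
def listProd {n : ℕ} (l : List (BMat n)) : BMat n := l.foldr bProd (bId n)

/-- A binary matrix is NZ if every row and every column contains a `1`. -/
def IsNZ {n : ℕ} (A : BMat n) : Prop :=
  (∀ i, ∃ j, A i j = true) ∧ (∀ j, ∃ i, A i j = true)

/-- `𝓜^{≤t}`: all boolean products of at most `t` matrices from `M`. -/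
def prodsLe {n : ℕ} (M : Set (BMat n)) (t : ℕ) : Set (BMat n) :=
  { P | ∃ l : List (BMat n), l.length ≤ t ∧ (∀ A ∈ l, A ∈ M) ∧ P = listProd l }

/-- `𝓜^{t}`: all boolean products of exactly `t` matrices from `M`. -/
def prodsEq {n : ℕ} (M : Set (BMat n)) (t : ℕ) : Set (BMat n) :=
  { P | ∃ l : List (BMat n), l.length = t ∧ (∀ A ∈ l, A ∈ M) ∧ P = listProd l }

/-- `(Ae)_i`: the number of `1`-entries in row `i` of `A`, as a real number. -/
def rowSum {n : ℕ} (A : BMat n) (i : Fin n) : ℝ :=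
  ∑ j, if A i j then (1 : ℝ) else 0

/-- The number of `1`-entries in row `i` of `A`, as a natural number. -/
def rCount {n : ℕ} (A : BMat n) (i : Fin n) : ℕ :=
  (Finset.univ.filter fun j => A i j = true).card

/-- A stochastic vector: nonnegative entries summing to `1`. -/
def IsStochastic {m : ℕ} (p : Fin m → ℝ) : Prop :=
  (∀ i, 0 ≤ p i) ∧ ∑ i, p i = 1

/-- `pᵀ(Ae)`. -/
def payoff {n : ℕ} (p : Fin n → ℝ) (A : BMat n) : ℝ := ∑ i, p i * rowSum A i

/-- `max_{A ∈ 𝓜^{≤t}} pᵀ(Ae)`. -/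
noncomputable def maxPayoff {n : ℕ} (M : Set (BMat n)) (t : ℕ) (p : Fin n → ℝ) : ℝ :=
  sSup { x | ∃ A ∈ prodsLe M t, x = payoff p A }

/-- The synchronizing probability function
`K_𝓜(t) = min_p max_{A ∈ 𝓜^{≤t}} pᵀ(Ae)/n`. -/
noncomputable def Kval {n : ℕ} (M : Set (BMat n)) (t : ℕ) : ℝ :=
  sInf { v | ∃ p : Fin n → ℝ, IsStochastic p ∧ v = maxPayoff M t p } / n

/-- The set `P_t` of optimal stochastic vectors for `K_𝓜(t)`. -/
noncomputable def Pset {n : ℕ} (M : Set (BMat n)) (t : ℕ) : Set (Fin n → ℝ) :=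
  { p | IsStochastic p ∧ maxPayoff M t p = n * Kval M t }

/-- A set of binary matrices is primitive if some (nonempty) boolean product of its
elements equals the all-ones matrix. -/
def IsPrimitive {n : ℕ} (M : Set (BMat n)) : Prop :=
  ∃ l : List (BMat n), l ≠ [] ∧ (∀ A ∈ l, A ∈ M) ∧ listProd l = bOnes n

/-- The exponent of a primitive set: the length of its shortest positive product. -/
noncomputable def expM {n : ℕ} (M : Set (BMat n)) : ℕ :=
  sInf { t | ∃ l : List (BMat n),
    l.length = t ∧ l ≠ [] ∧ (∀ A ∈ l, A ∈ M) ∧ listProd l = bOnes n }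

/-- `max_{A ∈ 𝓜^{≤t}} r_i(A)`. -/
noncomputable def rowMaxN {n : ℕ} (M : Set (BMat n)) (t : ℕ) (i : Fin n) : ℕ :=
  sSup { r | ∃ A ∈ prodsLe M t, r = rCount A i }

/-- `min_{1≤i≤n} max_{A ∈ 𝓜^{≤t}} r_i(A)`. -/
noncomputable def KbarN {n : ℕ} (M : Set (BMat n)) (t : ℕ) : ℕ :=
  sInf { r | ∃ i : Fin n, r = rowMaxN M t i }

/-- The approximated synchronizing probability function
`K̄_𝓜(t) = (1/n)·min_i max_{A ∈ 𝓜^{≤t}} r_i(A)`. -/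
noncomputable def Kbar {n : ℕ} (M : Set (BMat n)) (t : ℕ) : ℝ := (KbarN M t : ℝ) / n

/-- `P̄_t`: the set of row indices attaining the minimum in `K̄_𝓜(t)`. -/
noncomputable def Pbar {n : ℕ} (M : Set (BMat n)) (t : ℕ) : Set (Fin n) :=
  { i | rowMaxN M t i = KbarN M t }

theorem rowSum_le {n : ℕ} (A : BMat n) (i : Fin n) : rowSum A i ≤ n := by
  calc rowSum A i ≤ ∑ _j : Fin n, (1 : ℝ) :=
        Finset.sum_le_sum fun j _ => by split_ifs <;> norm_num
    _ = n := by simp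

theorem rowSum_nonneg {n : ℕ} (A : BMat n) (i : Fin n) : 0 ≤ rowSum A i :=
  Finset.sum_nonneg fun j _ => by split_ifs <;> norm_num

theorem rowSum_le_sub_one {n : ℕ} {A : BMat n} {i j : Fin n} (h : A i j ≠ true) :
    rowSum A i ≤ n - 1 := by
  have hle : ∑ k, (if A i k then (1 : ℝ) else 0) ≤ ∑ k, (1 - if k = j then (1 : ℝ) else 0) := by
    refine Finset.sum_le_sum fun k _ => ?_
    by_cases hk : k = j
    · subst hk
      simp [h]
    · simp only [hk, if_false]
      split_ifs <;> norm_num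
  simpa [rowSum, Finset.sum_sub_distrib] using hle

theorem sum_rowSum_le {n : ℕ} {A : BMat n} (h : A ≠ bOnes n) :
    ∑ i, rowSum A i ≤ (n : ℝ) ^ 2 - 1 := by
  obtain ⟨i, j, hij⟩ : ∃ i j, A i j ≠ true := by
    by_contra! hA
    exact h (by ext i j; simp [bOnes, hA])
  calc ∑ k, rowSum A k ≤ ∑ k, ((n : ℝ) - if k = i then 1 else 0) := by
        refine Finset.sum_le_sum fun k _ => ?_
        by_cases hk : k = i
        · subst hk
          simpa using rowSum_le_sub_one hij
        · simpa [hk] using rowSum_le A k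
    _ = (n : ℝ) ^ 2 - 1 := by simp [Finset.sum_sub_distrib, sq]

theorem payoff_le {n : ℕ} {p : Fin n → ℝ} (hp : IsStochastic p) (A : BMat n) :
    payoff p A ≤ n := by
  calc payoff p A ≤ ∑ i, p i * n :=
        Finset.sum_le_sum fun i _ => mul_le_mul_of_nonneg_left (rowSum_le A i) (hp.1 i)
    _ = n := by rw [← Finset.sum_mul, hp.2, one_mul]

theorem payoff_nonneg {n : ℕ} {p : Fin n → ℝ} (hp : IsStochastic p) (A : BMat n) :
    0 ≤ payoff p A :=
  Finset.sum_nonneg fun i _ => mul_nonneg (hp.1 i) (rowSum_nonneg A i)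

theorem payoff_bOnes {n : ℕ} {p : Fin n → ℝ} (hp : IsStochastic p) :
    payoff p (bOnes n) = n := by
  simp [payoff, rowSum, bOnes, ← Finset.sum_mul, hp.2]

theorem payoff_le_maxPayoff {n : ℕ} {M : Set (BMat n)} {t : ℕ} {p : Fin n → ℝ}
    (hp : IsStochastic p) {A : BMat n} (hA : A ∈ prodsLe M t) :
    payoff p A ≤ maxPayoff M t p :=
  le_csSup ⟨n, by rintro _ ⟨B, -, rfl⟩; exact payoff_le hp B⟩ ⟨A, hA, rfl⟩

theorem maxPayoff_nonneg {n : ℕ} (M : Set (BMat n)) (t : ℕ) {p : Fin n → ℝ}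
    (hp : IsStochastic p) : 0 ≤ maxPayoff M t p :=
  Real.sSup_nonneg (by rintro _ ⟨A, -, rfl⟩; exact payoff_nonneg hp A)

theorem maxPayoff_le {n : ℕ} {M : Set (BMat n)} {t : ℕ} {p : Fin n → ℝ} {c : ℝ}
    (h : ∀ A ∈ prodsLe M t, payoff p A ≤ c) : maxPayoff M t p ≤ c :=
  csSup_le ⟨_, bId n, ⟨[], by simp, by simp, rfl⟩, rfl⟩ (by rintro _ ⟨A, hA, rfl⟩; exact h A hA)

theorem isStochastic_uniform {n : ℕ} (hn : 1 ≤ n) :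
    IsStochastic fun _ : Fin n => (n : ℝ)⁻¹ := by
  have : (n : ℝ) ≠ 0 := by positivity
  exact ⟨fun _ => by positivity, by simp [this]⟩

theorem Kval_le_maxPayoff_div {n : ℕ} (M : Set (BMat n)) (t : ℕ) {p : Fin n → ℝ}
    (hp : IsStochastic p) : Kval M t ≤ maxPayoff M t p / n :=
  div_le_div_of_nonneg_right
    (csInf_le ⟨0, by rintro _ ⟨q, hq, rfl⟩; exact maxPayoff_nonneg M t hq⟩ ⟨p, hp, rfl⟩)
    n.cast_nonneg

theorem one_le_Kval_of_bOnes_mem {n : ℕ} (hn : 1 ≤ n) {M : Set (BMat n)} {t : ℕ}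
    (h : bOnes n ∈ prodsLe M t) : 1 ≤ Kval M t := by
  have hpos : (0 : ℝ) < n := by exact_mod_cast hn
  rw [Kval, le_div_iff₀ hpos, one_mul]
  refine le_csInf ⟨_, _, isStochastic_uniform hn, rfl⟩ ?_
  rintro _ ⟨p, hp, rfl⟩
  exact (payoff_bOnes hp).symm.le.trans (payoff_le_maxPayoff hp h)

/-- if `K_𝓜(t) < 1` then `K_𝓜(t) ≤ (n²−1)/n²`. -/
theorem stmt_7 {n : ℕ} (hn : 1 ≤ n) (M : Set (BMat n)) (hfin : M.Finite)
    (hne : M.Nonempty) (hNZ : ∀ A ∈ M, IsNZ A) (t : ℕ)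
    (h : Kval M t < 1) :
    Kval M t ≤ ((n : ℝ) ^ 2 - 1) / (n : ℝ) ^ 2 := by
  have hpos : (0 : ℝ) < n := by exact_mod_cast hn
  have hmax : maxPayoff M t (fun _ => (n : ℝ)⁻¹) ≤ ((n : ℝ) ^ 2 - 1) / n := by
    refine maxPayoff_le fun A hA => ?_
    have hA1 : A ≠ bOnes n := by
      rintro rfl
      exact absurd h (one_le_Kval_of_bOnes_mem hn hA).not_gt
    rw [payoff, ← Finset.mul_sum, inv_mul_eq_div]
    exact div_le_div_of_nonneg_right (sum_rowSum_le hA1) hpos.le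
  calc Kval M t ≤ maxPayoff M t (fun _ => (n : ℝ)⁻¹) / n :=
        Kval_le_maxPayoff_div M t (isStochastic_uniform hn)
    _ ≤ ((n : ℝ) ^ 2 - 1) / n / n := div_le_div_of_nonneg_right hmax hpos.le
    _ = ((n : ℝ) ^ 2 - 1) / (n : ℝ) ^ 2 := by rw [div_div, sq (n : ℝ)]
end

section
/- Let 𝓜 be a primitive finite set of n×n binary NZ matrices and t ≥ 0 such that K̄_𝓜(t) = K̄_𝓜(t+1) = k/n < 1 for an integer k (so 1 ≤ k ≤ n−1), and |P̄_t| = n. Then K̄_𝓜( t + ⌈n²(k−1)/(2k)⌉ + n ) > K̄_𝓜(t). -/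
open scoped BigOperators

theorem bProd_eq_true {n : ℕ} {A B : BMat n} {i j : Fin n} :
    bProd A B i j = true ↔ ∃ k, A i k = true ∧ B k j = true := by
  simp [bProd]

theorem bId_eq_true {n : ℕ} {i j : Fin n} : bId n i j = true ↔ i = j := by
  simp [bId]

theorem listProd_append_eq_true {n : ℕ} (l₁ l₂ : List (BMat n)) {i j : Fin n} :
    listProd (l₁ ++ l₂) i j = true ↔
      ∃ k, listProd l₁ i k = true ∧ listProd l₂ k j = true := by
  induction l₁ generalizing i with
  | nil => simp [listProd, bId_eq_true]
  | cons A l ih =>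
    change bProd A (listProd (l ++ l₂)) i j = true ↔
      ∃ k, bProd A (listProd l) i k = true ∧ _
    simp only [bProd_eq_true, ih]
    grind

theorem exists_listProd_eq_true {n : ℕ} {M : Set (BMat n)} (hNZ : ∀ A ∈ M, IsNZ A)
    (l : List (BMat n)) (hl : ∀ A ∈ l, A ∈ M) (j : Fin n) :
    ∃ i, listProd l i j = true := by
  induction l with
  | nil => exact ⟨j, bId_eq_true.2 rfl⟩
  | cons A l ih =>
    obtain ⟨k, hk⟩ := ih fun B hB => hl B (List.mem_cons_of_mem _ hB)
    obtain ⟨i, hi⟩ := (hNZ A (hl A List.mem_cons_self)).2 k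
    exact ⟨i, bProd_eq_true.2 ⟨k, hi, hk⟩⟩

theorem prodsLe_mono {n : ℕ} (M : Set (BMat n)) : Monotone (prodsLe M) := by
  rintro s t h P ⟨l, hl, hM, rfl⟩
  exact ⟨l, hl.trans h, hM, rfl⟩

theorem bddAbove_rCount {n : ℕ} (M : Set (BMat n)) (t : ℕ) (i : Fin n) :
    BddAbove { r | ∃ A ∈ prodsLe M t, r = rCount A i } := by
  refine ⟨n, ?_⟩
  rintro r ⟨A, -, rfl⟩
  exact (Finset.card_le_univ _).trans_eq (Fintype.card_fin n)

theorem rCount_le_rowMaxN {n : ℕ} {M : Set (BMat n)} {t : ℕ} {A : BMat n}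
    (hA : A ∈ prodsLe M t) (i : Fin n) : rCount A i ≤ rowMaxN M t i :=
  le_csSup (bddAbove_rCount M t i) ⟨A, hA, rfl⟩

theorem exists_rCount_eq_rowMaxN {n : ℕ} (M : Set (BMat n)) (t : ℕ) (i : Fin n) :
    ∃ A ∈ prodsLe M t, rCount A i = rowMaxN M t i := by
  obtain ⟨A, hA, h⟩ := Nat.sSup_mem
    (s := { r | ∃ A ∈ prodsLe M t, r = rCount A i })
    ⟨_, bId n, ⟨[], Nat.zero_le _, by simp, rfl⟩, rfl⟩ (bddAbove_rCount M t i)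
  exact ⟨A, hA, h.symm⟩

theorem exists_rowMaxN_eq_KbarN {n : ℕ} (hn : 1 ≤ n) (M : Set (BMat n)) (t : ℕ) :
    ∃ i, rowMaxN M t i = KbarN M t := by
  obtain ⟨i, h⟩ := Nat.sInf_mem (s := { r | ∃ i : Fin n, r = rowMaxN M t i })
    ⟨_, ⟨0, hn⟩, rfl⟩
  exact ⟨i, h.symm⟩

/-- Unordered pairs of rows that some product of length at most `t` jointly sends to more
than `k` columns. -/
def goodPairs {n : ℕ} (M : Set (BMat n)) (t k : ℕ) : Set (Sym2 (Fin n)) :=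
  { p | ∃ B ∈ prodsLe M t, k < (Finset.univ.filter fun j => ∃ a ∈ p, B a j = true).card }

/-- Unordered pairs from which a pair in `G` is covered by a product of length at most `m`. -/
def pairsReaching {n : ℕ} (M : Set (BMat n)) (G : Set (Sym2 (Fin n))) (m : ℕ) :
    Set (Sym2 (Fin n)) :=
  { p | ∃ P ∈ prodsLe M m, ∃ q ∈ G, ∀ c ∈ q, ∃ a ∈ p, P a c = true }

theorem pairsReaching_mono {n : ℕ} (M : Set (BMat n)) (G : Set (Sym2 (Fin n))) :
    Monotone (pairsReaching M G) := by
  rintro s t h p ⟨P, hP, hq⟩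
  exact ⟨P, prodsLe_mono M h hP, hq⟩

theorem subset_pairsReaching {n : ℕ} (M : Set (BMat n)) (G : Set (Sym2 (Fin n))) (m : ℕ) :
    G ⊆ pairsReaching M G m := fun p hp =>
  ⟨bId n, ⟨[], Nat.zero_le _, by simp, rfl⟩, p, hp, fun c hc => ⟨c, hc, bId_eq_true.2 rfl⟩⟩

theorem pairsReaching_stable {n : ℕ} (M : Set (BMat n)) (G : Set (Sym2 (Fin n))) {m : ℕ}
    (h : pairsReaching M G m = pairsReaching M G (m + 1)) :
    pairsReaching M G (m + 1) = pairsReaching M G (m + 2) := by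
  refine (pairsReaching_mono M G (Nat.le_succ _)).antisymm ?_
  rintro p ⟨P, ⟨l, hl, hM, rfl⟩, q, hq, hpq⟩
  cases l with
  | nil => exact ⟨_, ⟨[], Nat.zero_le _, hM, rfl⟩, q, hq, hpq⟩
  | cons A l =>
    induction q using Sym2.ind with
    | _ c d =>
      obtain ⟨a, ha, hac⟩ := hpq c (Sym2.mem_mk_left c d)
      obtain ⟨b, hb, hbd⟩ := hpq d (Sym2.mem_mk_right c d)
      obtain ⟨a', haa, hac⟩ := bProd_eq_true.1 hac
      obtain ⟨b', hbb, hbd⟩ := bProd_eq_true.1 hbd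
      have hy : s(a', b') ∈ pairsReaching M G (m + 1) := by
        refine ⟨listProd l, ⟨l, by simpa using hl, fun B hB => hM B (by simp [hB]), rfl⟩,
          s(c, d), hq, ?_⟩
        intro x hx
        rcases Sym2.mem_iff.1 hx with rfl | rfl
        · exact ⟨a', by simp, hac⟩
        · exact ⟨b', by simp, hbd⟩
      rw [← h] at hy
      obtain ⟨Q, ⟨l', hl', hM', rfl⟩, r, hr, hrq⟩ := hy
      refine ⟨listProd (A :: l'), ⟨A :: l', by simpa using hl', ?_, rfl⟩, r, hr, ?_⟩
      · intro B hB
        rcases List.mem_cons.1 hB with rfl | hB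
        · exact hM _ (by simp)
        · exact hM' B hB
      · intro x hx
        obtain ⟨y, hy, hyx⟩ := hrq x hx
        rcases Sym2.mem_iff.1 hy with rfl | rfl
        · exact ⟨a, ha, bProd_eq_true.2 ⟨_, haa, hyx⟩⟩
        · exact ⟨b, hb, bProd_eq_true.2 ⟨_, hbb, hyx⟩⟩

theorem pairsReaching_subset_ncard_compl {n : ℕ} (M : Set (BMat n))
    (G : Set (Sym2 (Fin n))) (m : ℕ) :
    pairsReaching M G m ⊆ pairsReaching M G (Gᶜ).ncard := by
  have hmono : Monotone fun m => (pairsReaching M G m \ G).ncard := fun s t h =>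
    Set.ncard_le_ncard (Set.sdiff_subset_sdiff_left (pairsReaching_mono M G h)) (Set.toFinite _)
  have heq : ∀ s t, s ≤ t →
      (pairsReaching M G s \ G).ncard = (pairsReaching M G t \ G).ncard →
      pairsReaching M G s = pairsReaching M G t := by
    intro s t h hc
    have := Set.eq_of_subset_of_ncard_le
      (Set.sdiff_subset_sdiff_left (t := G) (pairsReaching_mono M G h)) hc.ge (Set.toFinite _)
    rw [← Set.sdiff_union_of_subset (subset_pairsReaching M G s), this,
      Set.sdiff_union_of_subset (subset_pairsReaching M G t)]
  rcases le_total m (Gᶜ).ncard with h | h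
  · exact pairsReaching_mono M G h
  · refine (heq _ _ h (Nat.stabilises_of_monotone hmono ?_ ?_ h).symm).ge
    · exact fun m => Set.ncard_le_ncard (fun x hx => hx.2) (Set.toFinite _)
    · intro m hm
      rw [pairsReaching_stable M G (heq _ _ (Nat.le_succ _) hm)]

theorem mem_goodPairs {n : ℕ} {M : Set (BMat n)} {t : ℕ} {B : BMat n}
    (hB : B ∈ prodsLe M t) {a b j : Fin n} (ha : B a j ≠ true) (hb : B b j = true) :
    s(a, b) ∈ goodPairs M t (rCount B a) := by
  refine ⟨B, hB, Finset.card_lt_card ?_⟩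
  refine Finset.ssubset_iff_of_subset ?_ |>.2 ⟨j, ?_, by simpa using ha⟩
  · intro x hx
    simp only [Finset.mem_filter, Finset.mem_univ, true_and] at hx ⊢
    exact ⟨a, by simp, hx⟩
  · simp only [Finset.mem_filter, Finset.mem_univ, true_and]
    exact ⟨b, by simp, hb⟩

theorem exists_mem_goodPairs {n : ℕ} {M : Set (BMat n)} (hNZ : ∀ A ∈ M, IsNZ A) {t k : ℕ}
    (hkn : k < n) (hk : ∀ i, rowMaxN M t i = k) : (goodPairs M t k).Nonempty := by
  have a : Fin n := ⟨0, by omega⟩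
  obtain ⟨B, hB, hBa⟩ := exists_rCount_eq_rowMaxN M t a
  rw [hk] at hBa
  have : ∃ j, B a j ≠ true := by
    by_contra! h
    simp [rCount, h] at hBa
    omega
  obtain ⟨j, hj⟩ := this
  obtain ⟨l, -, hM, rfl⟩ := id hB
  obtain ⟨b, hb⟩ := exists_listProd_eq_true hNZ l hM j
  exact ⟨_, hBa ▸ mem_goodPairs hB hj hb⟩

open Classical in
theorem le_mul_sub_degree {n : ℕ} {M : Set (BMat n)} (hNZ : ∀ A ∈ M, IsNZ A) {t k : ℕ}
    (hk : ∀ i, rowMaxN M t i = k) (a : Fin n) :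
    n ≤ (n - (SimpleGraph.fromEdgeSet (goodPairs M t k)ᶜ).degree a) * k := by
  set H := SimpleGraph.fromEdgeSet (goodPairs M t k)ᶜ with hH
  obtain ⟨B, hB, hBa⟩ := exists_rCount_eq_rowMaxN M t a
  rw [hk] at hBa
  have hcover : (Finset.univ : Finset (Fin n)) ⊆
      (H.neighborFinset a)ᶜ.biUnion fun b => Finset.univ.filter fun j => B b j = true := by
    intro j _
    simp only [Finset.mem_biUnion, Finset.mem_compl, SimpleGraph.mem_neighborFinset,
      Finset.mem_filter, Finset.mem_univ, true_and]
    by_cases hj : B a j = true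
    · exact ⟨a, H.irrefl, hj⟩
    · obtain ⟨l, -, hM, rfl⟩ := id hB
      obtain ⟨b, hb⟩ := exists_listProd_eq_true hNZ l hM j
      refine ⟨b, ?_, hb⟩
      rw [hH, SimpleGraph.fromEdgeSet_adj]
      exact fun h => h.1 (hBa ▸ mem_goodPairs hB hj hb)
  calc n = (Finset.univ : Finset (Fin n)).card := by simp
    _ ≤ _ := Finset.card_le_card hcover
    _ ≤ (H.neighborFinset a)ᶜ.card * k :=
      Finset.card_biUnion_le_card_mul _ _ _ fun b _ => hk b ▸ rCount_le_rowMaxN hB b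
    _ = _ := by rw [Finset.card_compl, Fintype.card_fin, SimpleGraph.card_neighborFinset_eq_degree]

open Classical in
theorem ncard_compl_goodPairs_le {n : ℕ} {M : Set (BMat n)} (hNZ : ∀ A ∈ M, IsNZ A)
    {t k : ℕ} (hk1 : 1 ≤ k) (hk : ∀ i, rowMaxN M t i = k) :
    ((goodPairs M t k)ᶜ).ncard ≤ ⌈((n : ℚ) ^ 2 * ((k : ℚ) - 1)) / (2 * (k : ℚ))⌉₊ + n := by
  set H := SimpleGraph.fromEdgeSet (goodPairs M t k)ᶜ with hH
  have hdeg : ∀ a, (k : ℚ) * H.degree a ≤ n * (k - 1) := by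
    intro a
    have h := le_mul_sub_degree hNZ hk a
    have hle : H.degree a ≤ n := (H.degree_lt_card_verts a).le.trans_eq (Fintype.card_fin n)
    have h' : (n : ℚ) ≤ (n - H.degree a) * k := by
      rw [← Nat.cast_sub hle]
      exact_mod_cast h
    linarith
  have hsum : (k : ℚ) * (2 * H.edgeFinset.card) ≤ n * (n * (k - 1)) := by
    have h : (∑ a, (H.degree a : ℚ)) = 2 * H.edgeFinset.card := by
      have h : ∑ a, H.degree a = 2 * H.edgeFinset.card := by
        convert H.sum_degrees_eq_twice_card_edges
      exact_mod_cast h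
    rw [← h, Finset.mul_sum]
    simpa using Finset.sum_le_sum fun a (_ : a ∈ Finset.univ) => hdeg a
  have hE : H.edgeFinset.card ≤ ⌈((n : ℚ) ^ 2 * ((k : ℚ) - 1)) / (2 * (k : ℚ))⌉₊ := by
    have hk0 : (0 : ℚ) < 2 * k := by positivity
    have : (H.edgeFinset.card : ℚ) ≤ ((n : ℚ) ^ 2 * ((k : ℚ) - 1)) / (2 * (k : ℚ)) := by
      rw [le_div_iff₀ hk0]
      linarith
    exact_mod_cast this.trans (Nat.le_ceil _)
  have hsub : (goodPairs M t k)ᶜ ⊆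
      ((H.edgeFinset ∪ Finset.univ.image Sym2.diag : Finset (Sym2 (Fin n))) : Set _) := by
    intro p hp
    induction p using Sym2.ind with
    | _ a b =>
      by_cases hab : a = b
      · subst hab
        simp [Sym2.diag]
      · simp [hH, hab]
        exact hp
  calc ((goodPairs M t k)ᶜ).ncard
      ≤ (H.edgeFinset ∪ Finset.univ.image Sym2.diag).card := by
        rw [← Set.ncard_coe_finset]
        exact Set.ncard_le_ncard hsub (Set.toFinite _)
    _ ≤ H.edgeFinset.card + (Finset.univ.image (Sym2.diag : Fin n → _)).card :=
        Finset.card_union_le _ _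
    _ ≤ _ := Nat.add_le_add hE (Finset.card_image_le.trans_eq (by simp))

/-- if `K̄_𝓜(t) = K̄_𝓜(t+1) = k/n < 1` with `k` an integer
(`1 ≤ k ≤ n−1`) and `|P̄_t| = n`, then
`K̄_𝓜(t + ⌈n²(k−1)/(2k)⌉ + n) > K̄_𝓜(t)`. -/
theorem stmt_14 {n : ℕ} (hn : 1 ≤ n) (M : Set (BMat n)) (hfin : M.Finite)
    (hNZ : ∀ A ∈ M, IsNZ A) (hprim : IsPrimitive M) (t k : ℕ) (hk1 : 1 ≤ k)
    (hkv : Kbar M t = (k : ℝ) / n) (heq : Kbar M t = Kbar M (t + 1))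
    (hlt : Kbar M t < 1) (hP : (Pbar M t).ncard = n) :
    Kbar M (t + ⌈((n : ℚ) ^ 2 * ((k : ℚ) - 1)) / (2 * (k : ℚ))⌉₊ + n) >
      Kbar M t := by
  have hn0 : (0 : ℝ) < n := by exact_mod_cast hn
  have hK : KbarN M t = k := by
    have h := hkv
    rw [Kbar, div_left_inj' hn0.ne'] at h
    exact_mod_cast h
  have hkn : k < n := by
    rw [hkv, div_lt_one hn0] at hlt
    exact_mod_cast hlt
  have hk : ∀ i, rowMaxN M t i = k := by
    intro i
    have huniv : Pbar M t = Set.univ :=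
      Set.eq_of_subset_of_ncard_le (Set.subset_univ _) (by simp [hP]) (Set.toFinite _)
    have hi : i ∈ Pbar M t := huniv ▸ Set.mem_univ i
    exact hi.trans hK
  obtain ⟨i, hi⟩ := exists_rowMaxN_eq_KbarN hn M
    (t + ⌈((n : ℚ) ^ 2 * ((k : ℚ) - 1)) / (2 * (k : ℚ))⌉₊ + n)
  rw [gt_iff_lt, Kbar, Kbar, div_lt_div_iff_of_pos_right hn0, Nat.cast_lt, hK, ← hi]
  have hreach : s(i, i) ∈ pairsReaching M (goodPairs M t k) ((goodPairs M t k)ᶜ).ncard := by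
    obtain ⟨W, -, hWM, hW⟩ := hprim
    obtain ⟨q, hq⟩ := exists_mem_goodPairs hNZ hkn hk
    refine pairsReaching_subset_ncard_compl M _ W.length
      ⟨_, ⟨W, le_rfl, hWM, rfl⟩, q, hq, fun c _ => ⟨i, by simp, ?_⟩⟩
    rw [hW]
    rfl
  obtain ⟨P, ⟨l₁, hl₁, hM₁, rfl⟩, q, ⟨B, ⟨l₂, hl₂, hM₂, rfl⟩, hlarge⟩, hcov⟩ := hreach
  have hmem : listProd (l₁ ++ l₂) ∈
      prodsLe M (t + ⌈((n : ℚ) ^ 2 * ((k : ℚ) - 1)) / (2 * (k : ℚ))⌉₊ + n) := by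
    refine ⟨l₁ ++ l₂, ?_, fun A hA => (List.mem_append.1 hA).elim (hM₁ A) (hM₂ A), rfl⟩
    have := ncard_compl_goodPairs_le hNZ hk1 hk
    rw [List.length_append]
    omega
  refine (hlarge.trans_le (Finset.card_le_card ?_)).trans_le (rCount_le_rowMaxN hmem i)
  intro j hj
  simp only [Finset.mem_filter, Finset.mem_univ, true_and] at hj ⊢
  obtain ⟨c, hc, hcj⟩ := hj
  obtain ⟨a, ha, hac⟩ := hcov c hc
  obtain rfl : a = i := by simpa using ha
  exact (listProd_append_eq_true l₁ l₂).2 ⟨c, hac, hcj⟩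
end
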